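/- arXiv:2507.17565 — 3 statements merged into one kernel-verified Lean document; each statement's English description precedes it below -/
import Mathlib

section
/- Let K ≥ 1. There exists a constant C > 0 depending only on s, c₀ and K such that for every triple (ξ₁, ξ₂, ξ₃) of real numbers with ξ₁ + ξ₂ + ξ₃ = 0, α₃(ξ₁,ξ₂,ξ₃) ≠ 0, max(|ξ₁|,|ξ₂|,|ξ₃|) ≥ N/2 and |ξ₂ − ξ₃| ≤ K·|ξ₁|, one has |σ₃(ξ₁,ξ₂,ξ₃)| ≤ C·|ξ₁|^{2s−2}·N^{2−2s}, and in particular |σ₃(ξ₁,ξ₂,ξ₃)| ≤ C·(1+K)^{2−2s}. -/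
open MeasureTheory Real

noncomputable section

/-- An admissible I-method multiplier `m`, with parameters `s`, `N`, `c₀`. -/
structure AdmissibleMultiplier (s N c₀ : ℝ) (m : ℝ → ℝ) : Prop where
  even : ∀ ξ : ℝ, m (-ξ) = m ξ
  smooth : ContDiff ℝ 2 m
  anti : ∀ ⦃a b : ℝ⦄, 0 ≤ a → a ≤ b → m b ≤ m a
  pos : ∀ ξ : ℝ, 0 < m ξ
  le_one : ∀ ξ : ℝ, m ξ ≤ 1
  eq_one : ∀ ξ : ℝ, |ξ| ≤ N → m ξ = 1
  eq_rpow : ∀ ξ : ℝ, 2 * N ≤ |ξ| → m ξ = N ^ (1 - s) * |ξ| ^ (s - 1)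
  cube_mono : ∀ ⦃a b : ℝ⦄, 0 ≤ a → a ≤ b → a ^ 3 * m a ^ 2 ≤ b ^ 3 * m b ^ 2
  deriv_le : ∀ ξ : ℝ, ξ ≠ 0 → |deriv m ξ| ≤ c₀ * m ξ / |ξ|
  deriv2_le : ∀ ξ : ℝ, ξ ≠ 0 → |deriv (deriv m) ξ| ≤ c₀ * m ξ / ξ ^ 2

/-- The denominator `α₃(ξ₁,ξ₂,ξ₃) = ξ₁³ + 4ξ₂³ + 4ξ₃³`. -/
def alpha3 (ξ₁ ξ₂ ξ₃ : ℝ) : ℝ := ξ₁ ^ 3 + 4 * ξ₂ ^ 3 + 4 * ξ₃ ^ 3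

/-- The multiplier `σ₃` associated with `m₁` (and `m₂(ξ) = m₁(2ξ)`); equal to `0`
by the junk-value convention where `α₃` vanishes. -/
def sigma3 (m₁ : ℝ → ℝ) (ξ₁ ξ₂ ξ₃ : ℝ) : ℝ :=
  (ξ₁ ^ 3 * m₁ ξ₁ ^ 2 + 4 * ξ₂ ^ 3 * m₁ (2 * ξ₂) ^ 2 + 4 * ξ₃ ^ 3 * m₁ (2 * ξ₃) ^ 2) /
    alpha3 ξ₁ ξ₂ ξ₃

/-- A crude second-difference estimate from a bound on the second derivative. -/
theorem abs_second_difference_le {f f' f'' : ℝ → ℝ} (hf : ∀ t, HasDerivAt f (f' t) t)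
    (hf' : ∀ t, HasDerivAt f' (f'' t) t) {x e M : ℝ}
    (hM : ∀ t, |t - x| ≤ |e| → |f'' t| ≤ M) :
    |f (x + e) + f (x - e) - 2 * f x| ≤ 2 * M * e ^ 2 := by
  have hM0 : 0 ≤ M := (abs_nonneg _).trans (hM x (by simp))
  have hball : ∀ t : ℝ, t ∈ Metric.closedBall x |e| → |t - x| ≤ |e| := fun t ht => by
    simpa [Real.dist_eq] using ht
  have hlip : ∀ t : ℝ, |t| ≤ |e| → |f' (x + t) - f' (x - t)| ≤ 2 * M * |e| := by
    intro t ht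
    have h := (convex_closedBall x |e|).norm_image_sub_le_of_norm_hasDerivWithin_le
      (f := f') (f' := f'') (C := M) (x := x - t) (y := x + t)
      (fun u _ => (hf' u).hasDerivWithinAt) (fun u hu => hM u (hball u hu))
      (by simpa [Real.dist_eq] using ht) (by simpa [Real.dist_eq] using ht)
    have h2 : x + t - (x - t) = 2 * t := by ring
    rw [h2, Real.norm_eq_abs, Real.norm_eq_abs, abs_mul, abs_two] at h
    nlinarith [mul_le_mul_of_nonneg_left ht hM0]
  have hg : ∀ t : ℝ, HasDerivAt (fun t => f (x + t) + f (x - t)) (f' (x + t) - f' (x - t)) t := by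
    intro t
    have h1 := (hf (x + t)).comp_const_add x t
    have h2 := (hf (x - t)).comp_const_sub x t
    rw [sub_eq_add_neg]
    exact h1.add h2
  have h := (convex_closedBall (0 : ℝ) |e|).norm_image_sub_le_of_norm_hasDerivWithin_le
    (f := fun t => f (x + t) + f (x - t)) (f' := fun t => f' (x + t) - f' (x - t))
    (C := 2 * M * |e|) (x := 0) (y := e)
    (fun u _ => (hg u).hasDerivWithinAt)
    (fun u hu => hlip u (by simpa [Real.dist_eq] using hu))
    (by simp) (by simp)
  simp only [add_zero, sub_zero, Real.norm_eq_abs] at h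
  calc |f (x + e) + f (x - e) - 2 * f x| = |f (x + e) + f (x - e) - (f x + f x)| := by
        rw [two_mul]
    _ ≤ 2 * M * |e| * |e| := h
    _ = 2 * M * e ^ 2 := by rw [mul_assoc, abs_mul_abs_self, sq]

namespace AdmissibleMultiplier

variable {s N c₀ : ℝ} {m : ℝ → ℝ}

theorem hasDerivAt (hm : AdmissibleMultiplier s N c₀ m) (t : ℝ) :
    HasDerivAt m (deriv m t) t :=
  (hm.smooth.differentiable (by norm_num) t).hasDerivAt

theorem hasDerivAt_deriv (hm : AdmissibleMultiplier s N c₀ m) (t : ℝ) :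
    HasDerivAt (deriv m) (deriv (deriv m) t) t := by
  have h : ContDiff ℝ 1 (deriv m) := by
    have h2 : ContDiff ℝ (1 + 1) m := by simpa [one_add_one_eq_two] using hm.smooth
    exact (contDiff_succ_iff_deriv.1 h2).2.2
  exact (h.differentiable (by norm_num) t).hasDerivAt

theorem hasDerivAt_cube_mul_sq (hm : AdmissibleMultiplier s N c₀ m) (t : ℝ) :
    HasDerivAt (fun t => t ^ 3 * m t ^ 2)
      (3 * t ^ 2 * m t ^ 2 + 2 * t ^ 3 * (m t * deriv m t)) t := by
  refine ((hasDerivAt_pow 3 t).mul ((hm.hasDerivAt t).pow 2)).congr_deriv ?_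
  simp only [Pi.pow_apply]
  push_cast
  ring

theorem hasDerivAt_deriv_cube_mul_sq (hm : AdmissibleMultiplier s N c₀ m) (t : ℝ) :
    HasDerivAt (fun t => 3 * t ^ 2 * m t ^ 2 + 2 * t ^ 3 * (m t * deriv m t))
      (6 * t * m t ^ 2 + 12 * t ^ 2 * (m t * deriv m t)
        + 2 * t ^ 3 * (deriv m t ^ 2 + m t * deriv (deriv m) t)) t := by
  refine ((((hasDerivAt_pow 2 t).const_mul 3).mul ((hm.hasDerivAt t).pow 2)).add
    (((hasDerivAt_pow 3 t).const_mul 2).mul ((hm.hasDerivAt t).mul (hm.hasDerivAt_deriv t)))).congr_deriv ?_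
  simp only [Pi.mul_apply, Pi.pow_apply]
  push_cast
  ring

theorem abs_deriv2_cube_mul_sq_le (hm : AdmissibleMultiplier s N c₀ m) (t : ℝ) :
    |6 * t * m t ^ 2 + 12 * t ^ 2 * (m t * deriv m t)
        + 2 * t ^ 3 * (deriv m t ^ 2 + m t * deriv (deriv m) t)|
      ≤ (6 + 14 * c₀ + 2 * c₀ ^ 2) * (|t| * m t ^ 2) := by
  rcases eq_or_ne t 0 with rfl | ht
  · simp
  have ht' : 0 < |t| := abs_pos.2 ht
  have hmt := hm.pos t
  have h1 : |t| * |deriv m t| ≤ c₀ * m t := by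
    have := (le_div_iff₀ ht').1 (hm.deriv_le t ht)
    linarith
  have h2 : |t| ^ 2 * |deriv (deriv m) t| ≤ c₀ * m t := by
    have := (le_div_iff₀ (by positivity : 0 < t ^ 2)).1 (hm.deriv2_le t ht)
    rw [sq_abs]
    linarith
  have h3 : (|t| * |deriv m t|) ^ 2 ≤ (c₀ * m t) ^ 2 := by gcongr
  calc _ ≤ |6 * t * m t ^ 2| + |12 * t ^ 2 * (m t * deriv m t)|
        + (|2 * t ^ 3 * deriv m t ^ 2| + |2 * t ^ 3 * (m t * deriv (deriv m) t)|) := by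
        rw [mul_add (2 * t ^ 3)]
        exact (abs_add_le _ _).trans (add_le_add (abs_add_le _ _) (abs_add_le _ _))
    _ = 6 * (|t| * m t ^ 2) + 12 * (|t| * m t) * (|t| * |deriv m t|)
        + (2 * |t| * (|t| * |deriv m t|) ^ 2
          + 2 * (|t| * m t) * (|t| ^ 2 * |deriv (deriv m) t|)) := by
        simp only [abs_mul, abs_pow, abs_of_pos hmt, Nat.abs_ofNat]
        ring
    _ ≤ 6 * (|t| * m t ^ 2) + 12 * (|t| * m t) * (c₀ * m t)
        + (2 * |t| * (c₀ * m t) ^ 2 + 2 * (|t| * m t) * (c₀ * m t)) := by gcongr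
    _ = _ := by ring

theorem le_two_mul_rpow (hm : AdmissibleMultiplier s N c₀ m) (hN : 0 < N) (hs : 0 ≤ s)
    (hs1 : s ≤ 1) {t : ℝ} (ht : t ≠ 0) : m t ≤ 2 * (N ^ (1 - s) * |t| ^ (s - 1)) := by
  have ht' : 0 < |t| := abs_pos.2 ht
  rcases le_total (2 * N) |t| with h | h
  · rw [hm.eq_rpow t h]
    have : 0 ≤ N ^ (1 - s) * |t| ^ (s - 1) := by positivity
    linarith
  · refine (hm.le_one t).trans ?_
    have e1 : N ^ (1 - s) * (2 * N) ^ (s - 1) = 2 ^ (s - 1) := by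
      rw [Real.mul_rpow zero_le_two hN.le, mul_left_comm, ← Real.rpow_add hN]
      simp
    have e2 : (2 : ℝ) ^ (s - 1) ≤ N ^ (1 - s) * |t| ^ (s - 1) := by
      rw [← e1]
      exact mul_le_mul_of_nonneg_left
        (Real.rpow_le_rpow_of_nonpos ht' h (by linarith)) (by positivity)
    have e3 : (2 : ℝ) ^ (-1 : ℝ) ≤ 2 ^ (s - 1) :=
      Real.rpow_le_rpow_of_exponent_le one_le_two (by linarith)
    rw [Real.rpow_neg_one] at e3
    linarith

theorem abs_mul_sq_le (hm : AdmissibleMultiplier s N c₀ m) (hN : 0 < N) (hs : 1 / 2 < s)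
    (hs1 : s ≤ 1) {t R : ℝ} (hR : |t| ≤ R) :
    |t| * m t ^ 2 ≤ 4 * (N ^ (2 - 2 * s) * R ^ (2 * s - 1)) := by
  have hR0 : 0 ≤ R := (abs_nonneg t).trans hR
  rcases eq_or_ne t 0 with rfl | ht
  · simp only [abs_zero, zero_mul]
    positivity
  have ht' : 0 < |t| := abs_pos.2 ht
  calc |t| * m t ^ 2 ≤ |t| * (2 * (N ^ (1 - s) * |t| ^ (s - 1))) ^ 2 := by
        gcongr
        · exact (hm.pos t).le
        · exact hm.le_two_mul_rpow hN (by linarith) hs1 ht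
    _ = 4 * ((N ^ (1 - s)) ^ 2 * (|t| * (|t| ^ (s - 1)) ^ 2)) := by ring
    _ = 4 * (N ^ (2 - 2 * s) * |t| ^ (2 * s - 1)) := by
        congr 2
        · rw [← Real.rpow_mul_natCast hN.le]
          congr 1
          push_cast
          ring
        · rw [← Real.rpow_mul_natCast ht'.le, ← Real.rpow_one_add' ht'.le]
          · congr 1
            push_cast
            ring
          · push_cast
            linarith
    _ ≤ 4 * (N ^ (2 - 2 * s) * R ^ (2 * s - 1)) := by
        gcongr
        linarith

end AdmissibleMultiplier

theorem alpha3_eq {ξ₁ ξ₂ ξ₃ : ℝ} (h : ξ₁ + ξ₂ + ξ₃ = 0) :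
    alpha3 ξ₁ ξ₂ ξ₃ = -3 * ξ₁ * (ξ₂ - ξ₃) ^ 2 := by
  obtain rfl : ξ₁ = -ξ₂ - ξ₃ := by linarith
  unfold alpha3
  ring

/-- On the plane `ξ₁ + ξ₂ + ξ₃ = 0`, `σ₃` is a second-order difference quotient of `t³ m(t)²`. -/
theorem abs_sigma3_eq {m : ℝ → ℝ} (heven : ∀ t, m (-t) = m t) {ξ₁ ξ₂ ξ₃ : ℝ}
    (h : ξ₁ + ξ₂ + ξ₃ = 0) :
    |sigma3 m ξ₁ ξ₂ ξ₃| =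
      |(ξ₁ + (ξ₂ - ξ₃)) ^ 3 * m (ξ₁ + (ξ₂ - ξ₃)) ^ 2
        + (ξ₁ - (ξ₂ - ξ₃)) ^ 3 * m (ξ₁ - (ξ₂ - ξ₃)) ^ 2 - 2 * (ξ₁ ^ 3 * m ξ₁ ^ 2)|
        / (6 * |ξ₁| * (ξ₂ - ξ₃) ^ 2) := by
  have e1 : ξ₁ + (ξ₂ - ξ₃) = -(2 * ξ₃) := by linarith
  have e2 : ξ₁ - (ξ₂ - ξ₃) = -(2 * ξ₂) := by linarith
  have hden : |alpha3 ξ₁ ξ₂ ξ₃| = 3 * |ξ₁| * (ξ₂ - ξ₃) ^ 2 := by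
    rw [alpha3_eq h, abs_mul, abs_mul, abs_of_nonneg (sq_nonneg (ξ₂ - ξ₃))]
    norm_num
  rw [sigma3, abs_div, hden, e1, e2, heven, heven,
    show (-(2 * ξ₃)) ^ 3 * m (2 * ξ₃) ^ 2 + (-(2 * ξ₂)) ^ 3 * m (2 * ξ₂) ^ 2
        - 2 * (ξ₁ ^ 3 * m ξ₁ ^ 2) = -2 * (ξ₁ ^ 3 * m ξ₁ ^ 2 + 4 * ξ₂ ^ 3 * m (2 * ξ₂) ^ 2
        + 4 * ξ₃ ^ 3 * m (2 * ξ₃) ^ 2) by ring, abs_mul,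
    show 6 * |ξ₁| * (ξ₂ - ξ₃) ^ 2 = 2 * (3 * |ξ₁| * (ξ₂ - ξ₃) ^ 2) by ring,
    show |(-2 : ℝ)| = 2 by norm_num, mul_div_mul_left _ _ two_ne_zero]

/-- Case (1) of Lemma 3.1: on the region `|ξ₂ - ξ₃| ≲ |ξ₁|` (with implicit constant `K`),
the multiplier `σ₃` is bounded by `C·|ξ₁|^{2s-2}·N^{2-2s}`, and in particular by
`C·(1+K)^{2-2s}`, with `C = C(s, c₀, K)`. -/
theorem sigma3_bound_case1 (s c₀ K : ℝ) (hs : 3 / 4 ≤ s) (hs1 : s < 1)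
    (hc₀ : 0 < c₀) (hK : 1 ≤ K) :
    ∃ C : ℝ, 0 < C ∧
      ∀ N : ℝ, 1 ≤ N → ∀ m₁ : ℝ → ℝ, AdmissibleMultiplier s N c₀ m₁ →
        ∀ ξ₁ ξ₂ ξ₃ : ℝ, ξ₁ + ξ₂ + ξ₃ = 0 → alpha3 ξ₁ ξ₂ ξ₃ ≠ 0 →
          N / 2 ≤ max |ξ₁| (max |ξ₂| |ξ₃|) → |ξ₂ - ξ₃| ≤ K * |ξ₁| →
          |sigma3 m₁ ξ₁ ξ₂ ξ₃| ≤ C * |ξ₁| ^ (2 * s - 2) * N ^ (2 - 2 * s) ∧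
          |sigma3 m₁ ξ₁ ξ₂ ξ₃| ≤ C * (1 + K) ^ (2 - 2 * s) := by
  have hA : 0 < 6 + 14 * c₀ + 2 * c₀ ^ 2 := by positivity
  refine ⟨4 / 3 * (6 + 14 * c₀ + 2 * c₀ ^ 2) * (1 + K) ^ (2 * s - 1), by positivity, ?_⟩
  intro N hN m₁ hm ξ₁ ξ₂ ξ₃ hsum hα hmax hdiff
  have hN0 : 0 < N := by linarith
  rw [alpha3_eq hsum] at hα
  have hξ₁ : ξ₁ ≠ 0 := by rintro rfl; simp at hα
  have hd : ξ₂ - ξ₃ ≠ 0 := by intro h; simp [h] at hα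
  have hx : 0 < |ξ₁| := abs_pos.2 hξ₁
  have hbound : |sigma3 m₁ ξ₁ ξ₂ ξ₃| ≤
      4 / 3 * (6 + 14 * c₀ + 2 * c₀ ^ 2) * (1 + K) ^ (2 * s - 1)
        * |ξ₁| ^ (2 * s - 2) * N ^ (2 - 2 * s) := by
    have hM : ∀ t, |t - ξ₁| ≤ |ξ₂ - ξ₃| → _ := fun t ht =>
      (hm.abs_deriv2_cube_mul_sq_le t).trans <| mul_le_mul_of_nonneg_left
        (hm.abs_mul_sq_le hN0 (by linarith) hs1.le (t := t) (R := (1 + K) * |ξ₁|) (by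
          have := abs_add_le (t - ξ₁) ξ₁
          rw [sub_add_cancel] at this
          linarith)) hA.le
    have h := abs_second_difference_le hm.hasDerivAt_cube_mul_sq
      hm.hasDerivAt_deriv_cube_mul_sq hM
    rw [abs_sigma3_eq hm.even hsum, div_le_iff₀ (by positivity)]
    refine h.trans_eq ?_
    rw [Real.mul_rpow (by linarith) hx.le,
      show 2 * s - 1 = (2 * s - 2) + 1 by ring, Real.rpow_add_one hx.ne']
    ring
  refine ⟨hbound, hbound.trans ?_⟩
  have hNx : N ≤ (1 + K) * |ξ₁| := by
    have h1 : |ξ₁| ≤ K * |ξ₁| := le_mul_of_one_le_left hx.le hK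
    have hd2 := abs_le.1 hdiff
    have hx1 := neg_abs_le ξ₁
    have hx2 := le_abs_self ξ₁
    have h2 : max |ξ₁| (max |ξ₂| |ξ₃|) ≤ (1 + K) * |ξ₁| / 2 := by
      refine max_le (by linarith) (max_le ?_ ?_) <;> rw [abs_le] <;>
        constructor <;> linarith [hd2.1, hd2.2]
    linarith
  rw [mul_assoc]
  refine mul_le_mul_of_nonneg_left ?_ (by positivity)
  calc |ξ₁| ^ (2 * s - 2) * N ^ (2 - 2 * s)
      ≤ |ξ₁| ^ (2 * s - 2) * ((1 + K) * |ξ₁|) ^ (2 - 2 * s) := by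
        gcongr
        linarith
    _ = (1 + K) ^ (2 - 2 * s) := by
        rw [Real.mul_rpow (by linarith) hx.le, mul_left_comm, ← Real.rpow_add hx]
        simp
end
end

section
/- Let f, g : ℝ → ℝ be continuously differentiable functions such that f, g, f′, g′ are all square-integrable on ℝ. Set M := (∫_ℝ (f(x)² + g(x)²) dx)^{1/2}, ‖(f,g)‖²_{H¹} := ∫_ℝ (f(x)² + g(x)² + f′(x)² + g′(x)²) dx, and E(f,g) := ∫_ℝ (f′(x)² + 4·g′(x)² − f(x)·g(x)²) dx. Then ‖(f,g)‖²_{H¹} ≤ E(f,g) + (3/8)·M^{10/3} + M², and |E(f,g)| ≤ 5·‖(f,g)‖²_{H¹} + (3/4)·M^{10/3}. -/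
open MeasureTheory Real

noncomputable section

/-- The Cauchy–Schwarz inequality for real integrals, in squared form. -/
theorem sq_integral_mul_le {α : Type*} [MeasurableSpace α] {μ : Measure α} {u v : α → ℝ}
    (hu : MemLp u 2 μ) (hv : MemLp v 2 μ) :
    (∫ x, u x * v x ∂μ) ^ 2 ≤ (∫ x, u x ^ 2 ∂μ) * ∫ x, v x ^ 2 ∂μ := by
  have huv : Integrable (fun x => u x * v x) μ := hu.integrable_mul hv
  have key : ∀ t : ℝ, 0 ≤ (∫ x, u x ^ 2 ∂μ) * (t * t) + (2 * ∫ x, u x * v x ∂μ) * t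
      + ∫ x, v x ^ 2 ∂μ := by
    intro t
    have h0 : 0 ≤ ∫ x, (t * t * u x ^ 2 + 2 * t * (u x * v x) + v x ^ 2) ∂μ :=
      integral_nonneg fun x => by
        have := sq_nonneg (t * u x + v x)
        simp only [Pi.zero_apply]
        linarith
    rw [integral_add ((hu.integrable_sq.const_mul _).fun_add (huv.const_mul _)) hv.integrable_sq,
      integral_add (hu.integrable_sq.const_mul _) (huv.const_mul _), integral_const_mul,
      integral_const_mul] at h0
    linarith
  have := discrim_le_zero key
  unfold discrim at this
  linarith

/-- Agmon's inequality on the line: `g(x)² ≤ ∫ |g g'|`. -/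
theorem sq_le_integral_abs_mul_deriv {g : ℝ → ℝ} (hg : Differentiable ℝ g)
    (hg2 : Integrable (fun x => g x ^ 2)) (hgg' : Integrable (fun x => g x * deriv g x)) (x : ℝ) :
    g x ^ 2 ≤ ∫ y, |g y * deriv g y| := by
  have hd : ∀ y, HasDerivAt (fun y => g y ^ 2) (2 * (g y * deriv g y)) y := fun y => by
    simpa [mul_assoc] using (hg y).hasDerivAt.fun_pow 2
  have hi : Integrable (fun y => 2 * (g y * deriv g y)) := hgg'.const_mul 2
  have hbot := tendsto_zero_of_hasDerivAt_of_integrableOn_Iic (a := x) (fun y _ => hd y)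
    hi.integrableOn hg2.integrableOn
  have htop := tendsto_zero_of_hasDerivAt_of_integrableOn_Ioi (a := x) (fun y _ => hd y)
    hi.integrableOn hg2.integrableOn
  have h1 := integral_Iic_of_hasDerivAt_of_tendsto' (a := x) (fun y _ => hd y) hi.integrableOn hbot
  have h2 := integral_Ioi_of_hasDerivAt_of_tendsto' (a := x) (fun y _ => hd y) hi.integrableOn htop
  have h3 := abs_integral_le_integral_abs (f := fun y => 2 * (g y * deriv g y))
    (μ := volume.restrict (Set.Iic x))
  have h4 := abs_integral_le_integral_abs (f := fun y => 2 * (g y * deriv g y))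
    (μ := volume.restrict (Set.Ioi x))
  have h5 := intervalIntegral.integral_Iic_add_Ioi (b := x) hi.abs.integrableOn hi.abs.integrableOn
  have h6 : ∫ y, |2 * (g y * deriv g y)| = 2 * ∫ y, |g y * deriv g y| := by
    simp only [abs_mul, abs_two, integral_const_mul]
  rw [h1] at h3
  rw [h2] at h4
  have h7 := le_abs_self (g x ^ 2 - 0)
  have h8 := neg_abs_le (0 - g x ^ 2)
  linarith

/-- A weighted AM-GM inequality in four variables, three of them equal. -/
theorem mul_pow_three_le_add_pow_four {s u : ℝ} (hs : 0 ≤ s) (hu : 0 ≤ u) :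
    256 * (s * u ^ 3) ≤ (s + 3 * u) ^ 4 := by
  have : (s + 3 * u) ^ 4 - 256 * (s * u ^ 3)
      = (s - u) ^ 2 * (s ^ 2 + 14 * s * u + 81 * u ^ 2) := by ring
  have : 0 ≤ (s - u) ^ 2 * (s ^ 2 + 14 * s * u + 81 * u ^ 2) := by positivity
  linarith

/-- A Gagliardo–Nirenberg estimate for the cubic term `∫ f g²`, with its integrability. -/
theorem integrable_and_integral_mul_sq_pow_four_le {f g : ℝ → ℝ} (hf : Continuous f)
    (hg : ContDiff ℝ 1 g) (hf2 : Integrable (fun x => f x ^ 2))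
    (hg2 : Integrable (fun x => g x ^ 2)) (hg'2 : Integrable (fun x => deriv g x ^ 2)) :
    Integrable (fun x => f x * g x ^ 2) ∧
      (∫ x, f x * g x ^ 2) ^ 4 ≤
        (∫ x, f x ^ 2) ^ 2 * (∫ x, g x ^ 2) ^ 3 * ∫ x, deriv g x ^ 2 := by
  have hcg : Continuous g := hg.continuous
  have hcg' : Continuous (deriv g) := hg.continuous_deriv le_rfl
  have mf : MemLp f 2 := (memLp_two_iff_integrable_sq hf.aestronglyMeasurable).2 hf2
  have mg : MemLp g 2 := (memLp_two_iff_integrable_sq hcg.aestronglyMeasurable).2 hg2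
  have mg' : MemLp (deriv g) 2 := (memLp_two_iff_integrable_sq hcg'.aestronglyMeasurable).2 hg'2
  set B := ∫ y, |g y * deriv g y|
  have hsup : ∀ x, g x ^ 2 ≤ B := sq_le_integral_abs_mul_deriv (hg.differentiable one_ne_zero) hg2
    (mg.integrable_mul mg')
  have hB2 : B ^ 2 ≤ (∫ x, g x ^ 2) * ∫ x, deriv g x ^ 2 := by
    have := sq_integral_mul_le mg.abs mg'.abs
    simpa only [Pi.abs_apply, sq_abs, ← abs_mul] using this
  have hle : ∀ x, (g x ^ 2) ^ 2 ≤ B * g x ^ 2 := fun x => by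
    nlinarith [hsup x, sq_nonneg (g x)]
  have hg4 : Integrable (fun x => (g x ^ 2) ^ 2) :=
    (hg2.const_mul B).mono' ((hcg.pow 2).pow 2).aestronglyMeasurable
      (.of_forall fun x => by
        rw [Real.norm_of_nonneg (by positivity)]
        exact hle x)
  have mg2 : MemLp (fun x => g x ^ 2) 2 :=
    (memLp_two_iff_integrable_sq (hcg.pow 2).aestronglyMeasurable).2 hg4
  refine ⟨mf.integrable_mul mg2, ?_⟩
  have h1 := sq_integral_mul_le mf mg2
  have h2 : ∫ x, (g x ^ 2) ^ 2 ≤ B * ∫ x, g x ^ 2 := by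
    rw [← integral_const_mul]
    exact integral_mono hg4 (hg2.const_mul B) hle
  have hF : 0 ≤ ∫ x, f x ^ 2 := integral_nonneg fun x => sq_nonneg _
  have hG : 0 ≤ ∫ x, g x ^ 2 := integral_nonneg fun x => sq_nonneg _
  calc (∫ x, f x * g x ^ 2) ^ 4 = ((∫ x, f x * g x ^ 2) ^ 2) ^ 2 := by ring
    _ ≤ ((∫ x, f x ^ 2) * (B * ∫ x, g x ^ 2)) ^ 2 := by
      gcongr
      exact h1.trans (by gcongr)
    _ = (∫ x, f x ^ 2) ^ 2 * (∫ x, g x ^ 2) ^ 2 * B ^ 2 := by ring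
    _ ≤ (∫ x, f x ^ 2) ^ 2 * (∫ x, g x ^ 2) ^ 2 *
        ((∫ x, g x ^ 2) * ∫ x, deriv g x ^ 2) := by gcongr
    _ = _ := by ring

/-- Lemma 5.1: for `f, g ∈ H¹(ℝ)`, with `M = ‖(f,g)‖_{L²}`,
`‖(f,g)‖²_{H¹} ≤ E(f,g) + (3/8)·M^{10/3} + M²` and
`|E(f,g)| ≤ 5·‖(f,g)‖²_{H¹} + (3/4)·M^{10/3}`, where
`E(f,g) = ∫ (f'² + 4g'² − f·g²)`. -/
theorem energy_H1_relation (f g : ℝ → ℝ)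
    (hf : ContDiff ℝ 1 f) (hg : ContDiff ℝ 1 g)
    (hf2 : Integrable (fun x : ℝ => f x ^ 2))
    (hg2 : Integrable (fun x : ℝ => g x ^ 2))
    (hf'2 : Integrable (fun x : ℝ => deriv f x ^ 2))
    (hg'2 : Integrable (fun x : ℝ => deriv g x ^ 2)) :
    (∫ x : ℝ, (f x ^ 2 + g x ^ 2 + deriv f x ^ 2 + deriv g x ^ 2)) ≤
        (∫ x : ℝ, (deriv f x ^ 2 + 4 * deriv g x ^ 2 - f x * g x ^ 2)) +
          3 / 8 * Real.sqrt (∫ x : ℝ, (f x ^ 2 + g x ^ 2)) ^ ((10 : ℝ) / 3) +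
          Real.sqrt (∫ x : ℝ, (f x ^ 2 + g x ^ 2)) ^ 2 ∧
      |∫ x : ℝ, (deriv f x ^ 2 + 4 * deriv g x ^ 2 - f x * g x ^ 2)| ≤
        5 * (∫ x : ℝ, (f x ^ 2 + g x ^ 2 + deriv f x ^ 2 + deriv g x ^ 2)) +
          3 / 4 * Real.sqrt (∫ x : ℝ, (f x ^ 2 + g x ^ 2)) ^ ((10 : ℝ) / 3) := by
  obtain ⟨hfg, hI⟩ :=
    integrable_and_integral_mul_sq_pow_four_le hf.continuous hg hf2 hg2 hg'2
  have e1 : ∫ x, (f x ^ 2 + g x ^ 2) = (∫ x, f x ^ 2) + ∫ x, g x ^ 2 := integral_add hf2 hg2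
  have e2 : ∫ x, (f x ^ 2 + g x ^ 2 + deriv f x ^ 2 + deriv g x ^ 2) =
      (∫ x, f x ^ 2) + (∫ x, g x ^ 2) + (∫ x, deriv f x ^ 2) + ∫ x, deriv g x ^ 2 := by
    rw [integral_add ((hf2.fun_add hg2).fun_add hf'2) hg'2, integral_add (hf2.fun_add hg2) hf'2, e1]
  have e3 : ∫ x, (deriv f x ^ 2 + 4 * deriv g x ^ 2 - f x * g x ^ 2) =
      (∫ x, deriv f x ^ 2) + 4 * (∫ x, deriv g x ^ 2) - ∫ x, f x * g x ^ 2 := by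
    rw [integral_sub (hf'2.fun_add (hg'2.const_mul 4)) hfg, integral_add hf'2 (hg'2.const_mul 4),
      integral_const_mul]
  have hF : 0 ≤ ∫ x, f x ^ 2 := integral_nonneg fun x => sq_nonneg _
  have hG : 0 ≤ ∫ x, g x ^ 2 := integral_nonneg fun x => sq_nonneg _
  have hF' : 0 ≤ ∫ x, deriv f x ^ 2 := integral_nonneg fun x => sq_nonneg _
  have hG' : 0 ≤ ∫ x, deriv g x ^ 2 := integral_nonneg fun x => sq_nonneg _
  rw [e1, e2, e3]
  generalize (∫ x, f x ^ 2) = F at *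
  generalize (∫ x, g x ^ 2) = G at *
  generalize (∫ x, deriv f x ^ 2) = F' at *
  generalize (∫ x, deriv g x ^ 2) = S at *
  generalize (∫ x, f x * g x ^ 2) = I at *
  have hT0 : 0 ≤ √(F + G) ^ ((10 : ℝ) / 3) := by positivity
  have hT3 : (√(F + G) ^ ((10 : ℝ) / 3)) ^ 3 = (F + G) ^ 5 := by
    rw [← Real.rpow_natCast, ← Real.rpow_mul (Real.sqrt_nonneg _)]
    norm_num
    rw [show √(F + G) ^ 10 = (√(F + G) ^ 2) ^ 5 by ring, Real.sq_sqrt (by positivity)]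
  rw [Real.sq_sqrt (by positivity)]
  generalize √(F + G) ^ ((10 : ℝ) / 3) = T at *
  have hIT : I ^ 4 ≤ S * T ^ 3 := by
    calc I ^ 4 ≤ F ^ 2 * G ^ 3 * S := hI
      _ ≤ (F + G) ^ 2 * (F + G) ^ 3 * S := by gcongr <;> linarith
      _ = S * T ^ 3 := by rw [hT3]; ring
  have hST : 0 ≤ S * T ^ 3 := by positivity
  have hI3 : |I| ≤ 3 * S + 3 / 8 * T := by
    refine le_of_pow_le_pow_left₀ four_ne_zero (by positivity) ?_
    rw [Even.pow_abs (by decide)]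
    linarith [mul_pow_three_le_add_pow_four (s := 3 * S) (u := T / 8)
      (by positivity) (by positivity)]
  have hI1 : |I| ≤ S + 3 / 4 * T := by
    refine le_of_pow_le_pow_left₀ four_ne_zero (by positivity) ?_
    rw [Even.pow_abs (by decide)]
    linarith [mul_pow_three_le_add_pow_four (s := S) (u := T / 4) (by positivity) (by positivity)]
  constructor
  · linarith [le_abs_self I]
  · rw [abs_le] at hI1 ⊢
    constructor <;> linarith
end
end

section
/- Let ε > 0 and C₄ > 0 satisfy 10·C₄·ε ≤ 1. Let a ≤ b be real numbers and let h : [a,b] → [0,∞) be continuous with h(a) ≤ 8·ε², and suppose that h(t) ≤ 6·ε² + 2·C₄·ε³ + C₄·h(t)^{3/2} for every t ∈ [a,b]. Then h(t) ≤ 9·ε² for every t ∈ [a,b]. -/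
open Real Set

/-- The bootstrap/continuity argument: if `10·C₄·ε ≤ 1`, `h` is continuous and nonnegative
on `[a,b]`, `h(a) ≤ 8ε²`, and `h(t) ≤ 6ε² + 2C₄ε³ + C₄·h(t)^{3/2}` on `[a,b]`,
then `h(t) ≤ 9ε²` on `[a,b]`. -/
theorem bootstrap_energy_bound (ε C₄ : ℝ) (hε : 0 < ε) (hC : 0 < C₄)
    (hsmall : 10 * C₄ * ε ≤ 1) (a b : ℝ) (hab : a ≤ b) (h : ℝ → ℝ)
    (hcont : ContinuousOn h (Icc a b))
    (hnonneg : ∀ t ∈ Icc a b, 0 ≤ h t)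
    (ha : h a ≤ 8 * ε ^ 2)
    (hineq : ∀ t ∈ Icc a b, h t ≤ 6 * ε ^ 2 + 2 * C₄ * ε ^ 3 + C₄ * h t ^ ((3 : ℝ) / 2)) :
    ∀ t ∈ Icc a b, h t ≤ 9 * ε ^ 2 := by
  intro t ht
  by_contra! hlt
  have hmem : 9 * ε ^ 2 ∈ Icc (h a) (h t) := ⟨by nlinarith [sq_nonneg ε], hlt.le⟩
  obtain ⟨s, hs, hs9⟩ := intermediate_value_Icc ht.1
    (hcont.mono (Icc_subset_Icc_right ht.2)) hmem
  have hpow : (9 * ε ^ 2) ^ ((3 : ℝ) / 2) = 27 * ε ^ 3 := by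
    rw [show 9 * ε ^ 2 = (3 * ε) ^ (2 : ℝ) by rw [rpow_two]; ring,
      ← rpow_mul (by positivity), show (2 : ℝ) * (3 / 2) = (3 : ℕ) by norm_num, rpow_natCast]
    ring
  have hself := hineq s ⟨hs.1, hs.2.trans ht.2⟩
  rw [hs9, hpow] at hself
  nlinarith [mul_le_mul_of_nonneg_right hsmall (sq_nonneg ε), pow_pos hε 2]
end
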